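/- Let h : ℝⁿ → ℝⁿ (with ℝⁿ as EuclideanSpace ℝ (Fin n)) be a bijection such that h and its inverse h⁻¹ are differentiable everywhere, let g : ℝ → ℝ be differentiable with deriv g t > 0 for all t, and let f : ℝⁿ → ℝ be differentiable and strictly convex on all of ℝⁿ, attaining its global minimum at some point. Then F = g ∘ f ∘ h has exactly one stationary point x* (a point where the Fréchet derivative of F vanishes), and x* is the global minimum of F: F(x*) ≤ F(x) for all x. -/

import Mathlib

/-- A convex function is minimal at a point where its Fréchet derivative vanishes. -/
theorem ConvexOn.le_of_hasFDerivAt_zero {E : Type*} [NormedAddCommGroup E] [NormedSpace ℝ E]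
    {f : E → ℝ} (hf : ConvexOn ℝ Set.univ f) {x : E}
    (hx : HasFDerivAt f (0 : E →L[ℝ] ℝ) x) (y : E) : f x ≤ f y := by
  have hconv : ConvexOn ℝ Set.univ (f ∘ AffineMap.lineMap (k := ℝ) x y) :=
    hf.comp_affineMap (AffineMap.lineMap x y)
  have hderiv : HasDerivAt (f ∘ AffineMap.lineMap (k := ℝ) x y) 0 0 := by
    have hx' : HasFDerivAt f (0 : E →L[ℝ] ℝ) (AffineMap.lineMap (k := ℝ) x y 0) := by
      simpa using hx
    simpa using hx'.comp_hasDerivAt (0 : ℝ) AffineMap.hasDerivAt_lineMap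
  have hslope := hconv.le_slope_of_hasDerivAt (Set.mem_univ 0) (Set.mem_univ 1) one_pos hderiv
  simpa [slope_def_field] using hslope


/-- The generalised input-convex network `F = g ∘ f ∘ h` has exactly one stationary
point, and this stationary point is the global minimum of `F`. -/
theorem existsUnique_stationary_comp {n : ℕ}
    (h : EuclideanSpace ℝ (Fin n) → EuclideanSpace ℝ (Fin n))
    (hbij : Function.Bijective h) (hdiff : Differentiable ℝ h)
    (hinv : EuclideanSpace ℝ (Fin n) → EuclideanSpace ℝ (Fin n))
    (hinv_left : Function.LeftInverse hinv h)
    (hinv_right : Function.RightInverse hinv h)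
    (hinv_diff : Differentiable ℝ hinv)
    (g : ℝ → ℝ) (hg : Differentiable ℝ g) (hg' : ∀ t : ℝ, 0 < deriv g t)
    (f : EuclideanSpace ℝ (Fin n) → ℝ) (hf_diff : Differentiable ℝ f)
    (hf_conv : StrictConvexOn ℝ Set.univ f)
    (hmin : ∃ x₀ : EuclideanSpace ℝ (Fin n), ∀ x, f x₀ ≤ f x) :
    ∃ xstar : EuclideanSpace ℝ (Fin n),
      fderiv ℝ (g ∘ f ∘ h) xstar = 0 ∧
      (∀ x : EuclideanSpace ℝ (Fin n), fderiv ℝ (g ∘ f ∘ h) x = 0 → x = xstar) ∧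
      (∀ x : EuclideanSpace ℝ (Fin n), (g ∘ f ∘ h) xstar ≤ (g ∘ f ∘ h) x) := by
  have hg_mono : StrictMono g := strictMono_of_deriv_pos hg'
  obtain ⟨x₀, hx₀⟩ := hmin
  have hF_min : ∀ x, (g ∘ f ∘ h) (hinv x₀) ≤ (g ∘ f ∘ h) x := fun x => by
    simpa [hinv_right x₀] using hg_mono.monotone (hx₀ (h x))
  refine ⟨hinv x₀, ?_, fun x hx => ?_, hF_min⟩
  · exact IsLocalMin.fderiv_eq_zero (Filter.Eventually.of_forall hF_min)
  · have hF : HasFDerivAt (g ∘ f ∘ h) (0 : EuclideanSpace ℝ (Fin n) →L[ℝ] ℝ) (hinv (h x)) := by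
      rw [hinv_left x, ← hx]
      exact (hg.comp (hf_diff.comp hdiff) x).hasFDerivAt
    have hgf_eq : (g ∘ f ∘ h) ∘ hinv = g ∘ f := by
      rw [← Function.comp_assoc, Function.comp_assoc, hinv_right.comp_eq_id, Function.comp_id]
    have hgf := hF.comp (h x) (hinv_diff (h x)).hasFDerivAt
    rw [hgf_eq, ContinuousLinearMap.zero_comp] at hgf
    have hf_zero : fderiv ℝ f (h x) = 0 :=
      (smul_eq_zero.1 (((hg (f (h x))).hasDerivAt.comp_hasFDerivAt (h x)
        (hf_diff (h x)).hasFDerivAt).unique hgf)).resolve_left (hg' _).ne'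
    have hf_min := hf_conv.convexOn.le_of_hasFDerivAt_zero
      (hf_zero ▸ (hf_diff (h x)).hasFDerivAt)
    rw [← hf_conv.eq_of_isMinOn (fun y _ => hf_min y) (fun y _ => hx₀ y)
      (Set.mem_univ _) (Set.mem_univ _), hinv_left x]
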